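/- arXiv:2310.02197 — 3 statements merged into one kernel-verified Lean document; each statement's English description precedes it below -/
import Mathlib

section
/- Let F be the field with 2 elements and m ≥ 2. Let H₁ᵀ be the matrix over ZMod 2 whose rows are indexed by the nonzero points of F^m and whose columns are indexed by the lines of EG(m,2) not containing 0, with entry 1 iff the point lies on the line. Then the block matrix M = [ H₁ᵀ | 𝟙 | I ], obtained by appending an all-ones column and a (2^m−1)×(2^m−1) identity matrix, is self-orthogonal: M · Mᵀ = 0 over ZMod 2. -/
open Matrix

/-- A line of the Euclidean geometry `EG(m,q)`: a coset `a + F·b` of a one-dimensional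
linear subspace of `F^m`, realized as a `Finset` of points. -/
def IsLine (F : Type*) [Field F] [Fintype F] [DecidableEq F] (m : ℕ)
    (L : Finset (Fin m → F)) : Prop :=
  ∃ a b : Fin m → F, b ≠ 0 ∧ L = Finset.univ.image (fun t : F => a + t • b)

noncomputable instance (m : ℕ) :
    Fintype {L : Finset (Fin m → ZMod 2) //
      IsLine (ZMod 2) m L ∧ (0 : Fin m → ZMod 2) ∉ L} :=
  Fintype.ofFinite _

/-- The matrix `M = [ H₁ᵀ | 𝟙 | I ]` over `ZMod 2`: rows indexed by the nonzero points of
`F^m` (`F` the field with two elements), columns indexed by the lines of `EG(m,2)` not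
containing `0`, together with one all-ones column and the columns of a
`(2^m − 1) × (2^m − 1)` identity matrix. -/
def M0 (m : ℕ) :
    Matrix {v : Fin m → ZMod 2 // v ≠ 0}
      ({L : Finset (Fin m → ZMod 2) // IsLine (ZMod 2) m L ∧ (0 : Fin m → ZMod 2) ∉ L} ⊕
        (Unit ⊕ {v : Fin m → ZMod 2 // v ≠ 0})) (ZMod 2) :=
  Matrix.of fun v c =>
    Sum.elim (fun L => if v.1 ∈ L.1 then 1 else 0)
      (Sum.elim (fun _ => 1) (fun w => if v = w then 1 else 0)) c

/-- Over the field with two elements, the lines missing the origin are exactly the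
two-element sets of nonzero points. -/
theorem mem_powersetCard_two_iff_isLine (m : ℕ) (L : Finset (Fin m → ZMod 2)) :
    L ∈ (Finset.univ.erase (0 : Fin m → ZMod 2)).powersetCard 2 ↔
      IsLine (ZMod 2) m L ∧ (0 : Fin m → ZMod 2) ∉ L := by
  have huniv : (Finset.univ : Finset (ZMod 2)) = {0, 1} := by decide
  rw [Finset.mem_powersetCard, Finset.subset_erase, Finset.card_eq_two]
  constructor
  · rintro ⟨⟨-, h0⟩, a, b, hab, rfl⟩
    refine ⟨⟨a, b - a, sub_ne_zero.mpr hab.symm, ?_⟩, h0⟩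
    simp [huniv, Finset.image_insert]
  · rintro ⟨⟨a, b, hb, rfl⟩, h0⟩
    refine ⟨⟨Finset.subset_univ _, h0⟩, a, a + b, by simpa using hb, ?_⟩
    simp [huniv, Finset.image_insert]

/-- A point of `s` lies in `s.card - 1` of the two-element subsets of `s`. -/
theorem card_filter_mem_powersetCard_two {α : Type*} [DecidableEq α] (s : Finset α) {v : α}
    (hv : v ∈ s) : ((s.powersetCard 2).filter (v ∈ ·)).card = s.card - 1 := by
  rw [← Finset.card_erase_of_mem hv]
  symm
  refine Finset.card_bij (fun w _ => {v, w}) ?_ ?_ ?_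
  · intro w hw
    obtain ⟨hwv, hws⟩ := Finset.mem_erase.mp hw
    simp [Finset.mem_powersetCard, Finset.insert_subset_iff, hv, hws, Finset.card_pair hwv.symm]
  · intro w hw w' _ h
    have hwv := (Finset.mem_erase.mp hw).1
    have : w ∈ ({v, w'} : Finset α) := by rw [← h]; simp
    simpa [hwv] using this
  · intro L hL
    obtain ⟨hL, hvL⟩ := Finset.mem_filter.mp hL
    obtain ⟨hLs, hc⟩ := Finset.mem_powersetCard.mp hL
    have h1 : (L.erase v).card = 1 := by rw [Finset.card_erase_of_mem hvL, hc]
    obtain ⟨w, hw⟩ := Finset.card_eq_one.mp h1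
    refine ⟨w, ?_, ?_⟩
    · exact Finset.erase_subset_erase v hLs (by simp [hw])
    · rw [← Finset.insert_erase hvL, hw]

/-- Two distinct points of `s` lie in exactly one common two-element subset of `s`. -/
theorem filter_mem_mem_powersetCard_two {α : Type*} [DecidableEq α] (s : Finset α) {v w : α}
    (hv : v ∈ s) (hw : w ∈ s) (hvw : v ≠ w) :
    (s.powersetCard 2).filter (fun L => v ∈ L ∧ w ∈ L) = {{v, w}} := by
  ext L
  simp only [Finset.mem_filter, Finset.mem_powersetCard, Finset.mem_singleton]
  constructor
  · rintro ⟨⟨-, hc⟩, hvL, hwL⟩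
    refine (Finset.eq_of_subset_of_card_le ?_ ?_).symm
    · simp [Finset.insert_subset_iff, hvL, hwL]
    · rw [hc, Finset.card_pair hvw]
  · rintro rfl
    simp [Finset.insert_subset_iff, hv, hw, Finset.card_pair hvw]

/-- The inner product of two rows of the point-line incidence matrix counts common lines. -/
theorem sum_incidence_mul_incidence (m : ℕ) (v w : Fin m → ZMod 2) :
    ∑ L : {L : Finset (Fin m → ZMod 2) // IsLine (ZMod 2) m L ∧ (0 : Fin m → ZMod 2) ∉ L},
      ((if v ∈ L.1 then 1 else 0) * (if w ∈ L.1 then 1 else 0) : ZMod 2) =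
    (((Finset.univ.erase (0 : Fin m → ZMod 2)).powersetCard 2).filter
      (fun L => v ∈ L ∧ w ∈ L)).card := by
  rw [← Finset.sum_subtype _ (mem_powersetCard_two_iff_isLine m)
    (fun L => ((if v ∈ L then 1 else 0) * (if w ∈ L then 1 else 0) : ZMod 2)),
    ← Finset.sum_boole]
  refine Finset.sum_congr rfl fun L _ => ?_
  by_cases hv : v ∈ L <;> by_cases hw : w ∈ L <;> simp [hv, hw]

theorem stmt_0 (m : ℕ) (hm : 2 ≤ m) : M0 m * (M0 m)ᵀ = 0 := by
  ext v w
  have hv : v.1 ∈ Finset.univ.erase (0 : Fin m → ZMod 2) := by simpa using v.2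
  have hw : w.1 ∈ Finset.univ.erase (0 : Fin m → ZMod 2) := by simpa using w.2
  simp only [Matrix.mul_apply, Matrix.transpose_apply, M0, Matrix.of_apply, Fintype.sum_sum_type,
    Sum.elim_inl, Sum.elim_inr, sum_incidence_mul_incidence, Matrix.zero_apply]
  by_cases hvw : v = w
  · subst hvw
    have heven : ((2 ^ m - 1 - 1 : ℕ) : ZMod 2) = 0 := by
      rw [ZMod.natCast_eq_zero_iff, Nat.sub_sub]
      exact Nat.dvd_sub (dvd_pow_self 2 (by omega)) (dvd_refl 2)
    simp only [and_self, card_filter_mem_powersetCard_two _ hv]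
    simp [Finset.card_erase_of_mem, ZMod.card, heven]
    decide
  · rw [filter_mem_mem_powersetCard_two _ hv hw (fun h => hvw (Subtype.ext h))]
    simp [hvw]
    decide
end

section
/- Let q be a prime power, F a finite field with q elements, and m ≥ 2. Let H₂ᵀ be the matrix over ZMod 2 whose rows are indexed by all points of F^m and whose columns are indexed by all lines of EG(m,q), with entry 1 iff the point lies on the line. If q is even with m ≥ 3, or both q and m are odd, then M = [ H₂ᵀ | 𝟙 ], obtained by appending an all-ones column, is self-orthogonal: M · Mᵀ = 0 over ZMod 2. -/
open Matrix

noncomputable instance (F : Type*) [Field F] [Fintype F] [DecidableEq F] (m : ℕ) :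
    Fintype {L : Finset (Fin m → F) // IsLine F m L} :=
  Fintype.ofFinite _

/-- The matrix `M = [ H₂ᵀ | 𝟙 ]` over `ZMod 2`: rows indexed by all points of `F^m`,
columns indexed by all lines of `EG(m,q)` together with one extra all-ones column. -/
def M1 (F : Type*) [Field F] [Fintype F] [DecidableEq F] (m : ℕ) :
    Matrix (Fin m → F) ({L : Finset (Fin m → F) // IsLine F m L} ⊕ Unit) (ZMod 2) :=
  Matrix.of fun p c =>
    Sum.elim (fun L => if p ∈ L.1 then 1 else 0) (fun _ => 1) c

theorem IsLine.eq_image {F : Type*} [Field F] [Fintype F] [DecidableEq F] {m : ℕ}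
    {L : Finset (Fin m → F)} (hL : IsLine F m L) {p x : Fin m → F} (hp : p ∈ L) (hx : x ∈ L)
    (hpx : p ≠ x) : L = Finset.univ.image (fun t : F => p + t • (x - p)) := by
  obtain ⟨a, b, -, rfl⟩ := hL
  simp only [Finset.mem_image, Finset.mem_univ, true_and] at hp hx
  obtain ⟨s, rfl⟩ := hp
  obtain ⟨u, rfl⟩ := hx
  have hus : u - s ≠ 0 := by
    intro h
    exact hpx (by rw [sub_eq_zero.mp h])
  ext y
  simp only [Finset.mem_image, Finset.mem_univ, true_and]
  constructor
  · rintro ⟨t, rfl⟩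
    refine ⟨(t - s) / (u - s), ?_⟩
    ext i
    simp only [Pi.add_apply, Pi.smul_apply, Pi.sub_apply, smul_eq_mul]
    field_simp
    ring
  · rintro ⟨t, rfl⟩
    refine ⟨s + t * (u - s), ?_⟩
    ext i
    simp only [Pi.add_apply, Pi.smul_apply, Pi.sub_apply, smul_eq_mul]
    ring

theorem IsLine.card_eq {F : Type*} [Field F] [Fintype F] [DecidableEq F] {m : ℕ}
    {L : Finset (Fin m → F)} (hL : IsLine F m L) : L.card = Fintype.card F := by
  obtain ⟨a, b, hb, rfl⟩ := hL
  rw [Finset.card_image_of_injective, Finset.card_univ]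
  intro s t hst
  exact smul_left_injective F hb (add_left_cancel hst)

/-- Exactly one line passes through two distinct points. -/
theorem card_lines_through_pair (F : Type*) [Field F] [Fintype F] [DecidableEq F] {m : ℕ}
    {p x : Fin m → F} (hpx : p ≠ x) :
    (Finset.univ.filter fun L : {L : Finset (Fin m → F) // IsLine F m L} =>
      p ∈ L.1 ∧ x ∈ L.1).card = 1 := by
  rw [Finset.card_eq_one]
  refine ⟨⟨_, p, x - p, sub_ne_zero.mpr hpx.symm, rfl⟩, ?_⟩
  ext L
  simp only [Finset.mem_filter, Finset.mem_univ, true_and, Finset.mem_singleton]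
  constructor
  · rintro ⟨hp, hx⟩
    exact Subtype.ext (L.2.eq_image hp hx hpx)
  · rintro rfl
    simp only [Finset.mem_image, Finset.mem_univ, true_and]
    exact ⟨⟨0, by simp⟩, ⟨1, by simp⟩⟩

/-- The number of lines through a point is `1 + q + ⋯ + q ^ (m - 1)`. -/
theorem card_lines_through_point (F : Type*) [Field F] [Fintype F] [DecidableEq F] {m : ℕ}
    (p : Fin m → F) :
    (Finset.univ.filter fun L : {L : Finset (Fin m → F) // IsLine F m L} => p ∈ L.1).card =
      ∑ i ∈ Finset.range m, Fintype.card F ^ i := by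
  have hq : 1 < Fintype.card F := Fintype.one_lt_card
  have hcount := Finset.sum_card_bipartiteAbove_eq_sum_card_bipartiteBelow
    (s := Finset.univ.filter fun L : {L : Finset (Fin m → F) // IsLine F m L} => p ∈ L.1)
    (t := Finset.univ.erase p) (fun L x => x ∈ L.1)
  rw [Finset.sum_congr rfl (g := fun _ => Fintype.card F - 1),
    Finset.sum_congr (s₁ := Finset.univ.erase p) rfl (g := fun _ => 1)] at hcount
  · simp only [Finset.sum_const, smul_eq_mul, mul_one, Finset.card_erase_of_mem,
      Finset.mem_univ, Finset.card_univ, Fintype.card_fun, Fintype.card_fin] at hcount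
    apply Nat.eq_of_mul_eq_mul_right (Nat.sub_pos_of_lt hq)
    rw [hcount, geom_sum_mul_of_one_le hq.le]
  · intro x hx
    rw [Finset.bipartiteBelow, Finset.filter_filter]
    exact card_lines_through_pair F (Finset.ne_of_mem_erase hx).symm
  · intro L hL
    rw [Finset.bipartiteAbove, ← L.2.card_eq,
      ← Finset.card_erase_of_mem (Finset.mem_filter.mp hL).2]
    congr 1
    ext x
    simp

theorem odd_geom_sum {q m : ℕ} (h : (Even q ∧ 1 ≤ m) ∨ (Odd q ∧ Odd m)) :
    Odd (∑ i ∈ Finset.range m, q ^ i) := by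
  rcases h with ⟨hq, hm⟩ | ⟨hq, hm⟩
  · obtain ⟨n, rfl⟩ := Nat.exists_eq_add_of_le' hm
    rw [Finset.sum_range_succ']
    refine Even.add_odd (Finset.even_sum _ fun i _ => ?_) (by simp)
    exact hq.pow_of_ne_zero i.succ_ne_zero
  · rw [Finset.odd_sum_iff_odd_card_odd, Finset.filter_true_of_mem fun i _ => hq.pow]
    simpa using hm

theorem stmt_1 (q : ℕ) (hq : IsPrimePow q) (F : Type*) [Field F] [Fintype F] [DecidableEq F]
    (hcard : Fintype.card F = q) (m : ℕ) (hm : 2 ≤ m)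
    (h : (Even q ∧ 3 ≤ m) ∨ (Odd q ∧ Odd m)) :
    M1 F m * (M1 F m)ᵀ = 0 := by
  ext p x
  have key : Odd (Finset.univ.filter fun L : {L : Finset (Fin m → F) // IsLine F m L} =>
      p ∈ L.1 ∧ x ∈ L.1).card := by
    by_cases hpx : p = x
    · subst hpx
      simp only [and_self]
      rw [card_lines_through_point, hcard]
      exact odd_geom_sum (h.imp_left fun h => ⟨h.1, by omega⟩)
    · rw [card_lines_through_pair F hpx]
      exact odd_one
  have hsum : (M1 F m * (M1 F m)ᵀ) p x =
      ((Finset.univ.filter fun L : {L : Finset (Fin m → F) // IsLine F m L} =>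
        p ∈ L.1 ∧ x ∈ L.1).card : ZMod 2) + 1 := by
    simp [Matrix.mul_apply, M1, Fintype.sum_sum_type, ← ite_and, and_comm]
  rw [hsum, (ZMod.natCast_eq_one_iff_odd).mpr key]
  rfl
end

section
/- Let F be the field with 2 elements and m ≥ 2. Let M = [ H₁ᵀ | 𝟙 | I ] be the matrix over ZMod 2 whose rows are indexed by the nonzero points of F^m and whose columns are indexed by the lines of EG(m,2) not containing 0, together with one extra all-ones column and the columns of a (2^m−1)×(2^m−1) identity matrix, where the (p, L) entry is 1 iff point p lies on line L. Then every nonzero vector x (indexed by the columns of M) satisfying M · x = 0 over ZMod 2 has Hamming weight at least 3. (That is, the binary linear code with parity-check matrix M has minimum distance at least 3 = q + 1 for q = 2.) -/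
open Matrix

/-- The matrix `M = [ H₁ᵀ | 𝟙 | I ]` over `ZMod 2`: rows indexed by the nonzero points of
`F^m` (`F` the field with two elements), columns indexed by the lines of `EG(m,2)` not
containing `0`, together with one all-ones column and the columns of a
`(2^m − 1) × (2^m − 1)` identity matrix. -/
def M8 (m : ℕ) :
    Matrix {v : Fin m → ZMod 2 // v ≠ 0}
      ({L : Finset (Fin m → ZMod 2) // IsLine (ZMod 2) m L ∧ (0 : Fin m → ZMod 2) ∉ L} ⊕
        (Unit ⊕ {v : Fin m → ZMod 2 // v ≠ 0})) (ZMod 2) :=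
  Matrix.of fun v c =>
    Sum.elim (fun L => if v.1 ∈ L.1 then 1 else 0)
      (Sum.elim (fun _ => 1) (fun w => if v = w then 1 else 0)) c

/-- A parity-check matrix over `ZMod 2` with nonzero, pairwise distinct columns defines a code of
minimum distance at least 3. -/
theorem three_le_card_support_of_mulVec_eq_zero {ι κ : Type*} [Fintype κ]
    (A : Matrix ι κ (ZMod 2)) (h0 : ∀ c, Aᵀ c ≠ 0) (hinj : Function.Injective Aᵀ)
    (x : κ → ZMod 2) (hx : x ≠ 0) (hker : A.mulVec x = 0) :
    3 ≤ (Finset.univ.filter fun c => x c ≠ 0).card := by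
  classical
  have hsum : ∀ v, ∑ c ∈ Finset.univ.filter (fun c => x c ≠ 0), A v c = 0 := by
    intro v
    refine Eq.trans ?_ (congrFun hker v)
    simp only [mulVec, dotProduct, Finset.sum_filter]
    refine Finset.sum_congr rfl fun c _ => ?_
    have hz : ∀ a b : ZMod 2, (if a ≠ 0 then b else 0) = b * a := by decide
    exact hz _ _
  by_contra! hlt
  generalize hS : Finset.univ.filter (fun c => x c ≠ 0) = S at hsum hlt
  have hcard : S.card = 0 ∨ S.card = 1 ∨ S.card = 2 := by omega
  rcases hcard with h | h | h
  · rw [Finset.card_eq_zero] at h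
    apply hx
    ext c
    by_contra hc
    have : c ∈ S := by rw [← hS]; simpa using hc
    simp [h] at this
  · obtain ⟨c, rfl⟩ := Finset.card_eq_one.1 h
    exact h0 c (funext fun v => by simpa using hsum v)
  · obtain ⟨c, d, hcd, rfl⟩ := Finset.card_eq_two.1 h
    refine hcd (hinj ?_)
    ext v
    have hz : ∀ a b : ZMod 2, a + b = 0 → a = b := by decide
    exact hz _ _ ((Finset.sum_pair hcd).symm.trans (hsum v))

/-- A line of a Euclidean geometry over the field with two elements has exactly two points. -/
theorem IsLine.card_eq_two {m : ℕ} {L : Finset (Fin m → ZMod 2)} (hL : IsLine (ZMod 2) m L) :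
    L.card = 2 := by
  obtain ⟨a, b, hb, rfl⟩ := hL
  rw [Finset.card_image_of_injective, Finset.card_univ, ZMod.card]
  intro s t hst
  exact smul_left_injective (ZMod 2) hb (add_left_cancel hst)

/-- The space `F^m` over the field with two elements has at least three nonzero points if
`2 ≤ m`. -/
theorem three_le_card_ne_zero {m : ℕ} (hm : 2 ≤ m) :
    3 ≤ (Finset.univ.filter fun v : Fin m → ZMod 2 => v ≠ 0).card := by
  rw [Finset.filter_ne', Finset.card_erase_of_mem (Finset.mem_univ _), Finset.card_univ,
    Fintype.card_fun, ZMod.card, Fintype.card_fin]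
  have := Nat.pow_le_pow_right (n := 2) (by norm_num) hm
  omega

theorem M8_col_ne_zero {m : ℕ} (hm : 2 ≤ m) (c) : (M8 m)ᵀ c ≠ 0 := by
  intro h
  rcases c with ⟨L, hL, h0⟩ | _ | w
  · obtain ⟨v, hv⟩ : L.Nonempty := by
      rw [← Finset.card_pos, hL.card_eq_two]; norm_num
    have := congrFun h ⟨v, fun hv0 => h0 (hv0 ▸ hv)⟩
    simp [M8, hv] at this
  · obtain ⟨v, hv⟩ : (Finset.univ.filter fun v : Fin m → ZMod 2 => v ≠ 0).Nonempty := by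
      rw [← Finset.card_pos]; have := three_le_card_ne_zero hm; omega
    have := congrFun h ⟨v, (Finset.mem_filter.1 hv).2⟩
    simp [M8] at this
  · have := congrFun h w
    simp [M8] at this

theorem M8_col_injective {m : ℕ} (hm : 2 ≤ m) : Function.Injective (M8 m)ᵀ := by
  have hcard := three_le_card_ne_zero hm
  have key : (M8 m)ᵀ = Sum.elim (fun L v => if v.1 ∈ L.1 then 1 else 0)
      (Sum.elim (fun _ _ => 1) (fun w v => if v = w then 1 else 0)) := by
    ext c v
    rcases c with L | _ | w <;> rfl
  rw [key]
  refine Function.Injective.sumElim ?_ (Function.Injective.sumElim ?_ ?_ ?_) ?_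
  · rintro ⟨L, hL, hL0⟩ ⟨K, hK, hK0⟩ h
    ext v
    by_cases hv : v = 0
    · simp [hv, hL0, hK0]
    · have := congrFun h ⟨v, hv⟩
      by_cases h1 : v ∈ L <;> by_cases h2 : v ∈ K <;> simp_all
  · exact fun _ _ _ => rfl
  · intro w w' h
    have := congrFun h w
    by_contra hne
    simp [hne] at this
  · intro _ w h
    have hsub : (Finset.univ.filter fun v : Fin m → ZMod 2 => v ≠ 0) ⊆ {w.1} := by
      intro v hv
      have := congrFun h ⟨v, (Finset.mem_filter.1 hv).2⟩
      by_contra hne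
      simp [Subtype.ext_iff, Finset.mem_singleton.not.1 hne] at this
    have := Finset.card_le_card hsub
    rw [Finset.card_singleton] at this
    omega
  · rintro ⟨L, hL, hL0⟩ (_ | w) h
    · have hsub : (Finset.univ.filter fun v : Fin m → ZMod 2 => v ≠ 0) ⊆ L := by
        intro v hv
        have := congrFun h ⟨v, (Finset.mem_filter.1 hv).2⟩
        by_contra hne
        simp [hne] at this
      have := Finset.card_le_card hsub
      rw [hL.card_eq_two] at this
      omega
    · have hsub : L ⊆ {w.1} := by
        intro v hv
        have := congrFun h ⟨v, fun hv0 => hL0 (hv0 ▸ hv)⟩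
        by_contra hne
        simp [Subtype.ext_iff, hv, Finset.mem_singleton.not.1 hne] at this
      have := Finset.card_le_card hsub
      rw [hL.card_eq_two, Finset.card_singleton] at this
      omega

theorem stmt_8 (m : ℕ) (hm : 2 ≤ m)
    (x : ({L : Finset (Fin m → ZMod 2) //
        IsLine (ZMod 2) m L ∧ (0 : Fin m → ZMod 2) ∉ L} ⊕
        (Unit ⊕ {v : Fin m → ZMod 2 // v ≠ 0})) → ZMod 2)
    (hx : x ≠ 0) (hker : (M8 m).mulVec x = 0) :
    3 ≤ (Finset.univ.filter fun c => x c ≠ 0).card := by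
  exact three_le_card_support_of_mulVec_eq_zero (M8 m) (M8_col_ne_zero hm)
    (M8_col_injective hm) x hx hker
end
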